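/- arXiv:math/0501453 — 3 statements merged into one kernel-verified Lean document; each statement's English description precedes it below -/
import Mathlib

section
/- Let b > 1 be a real number and set q² = 1 − (1+√(1+8b³))/(4b³), r² = b − (1−√(1+8b³))/(4b²) (with q, r > 0) and p² = b·q²/r², so that 0 < p² < 1. Let w(x) = b·(1 − q²·sn(r·x)²), where sn is the Jacobi elliptic function of modulus p. Then ∫₀^{4K(p)/r} (2·w(x) − 1/(2b²))·sn(r·x)² dx < (2 − 1/(2b³)) · ∫₀^{4K(p)/r} w(x)·sn(r·x)² dx. (This is the strict Rayleigh-quotient estimate, coming from w(x) ≤ b with equality only at isolated points, which proves that the first positive eigenvalue of the Laplacian of the minimal Lagrangian Klein bottle K_{n,m} satisfies λ₁ < 2 − 1/(2b³), Proposition 5.3(1).) -/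
/-- The complete elliptic integral of the first kind,
`K(p) = ∫₀^{π/2} dθ/√(1 − p² sin²θ)`. -/
noncomputable def ellipticK (p : ℝ) : ℝ :=
  ∫ θ in (0:ℝ)..(Real.pi / 2), 1 / Real.sqrt (1 - p ^ 2 * Real.sin θ ^ 2)

/-- The complete elliptic integral of the second kind,
`E(p) = ∫₀^{π/2} √(1 − p² sin²θ) dθ`. -/
noncomputable def ellipticE (p : ℝ) : ℝ :=
  ∫ θ in (0:ℝ)..(Real.pi / 2), Real.sqrt (1 - p ^ 2 * Real.sin θ ^ 2)

/-- `sn`, `cn`, `dn` are the Jacobi elliptic functions of modulus `p`: the (unique) global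
solution of the system `sn' = cn·dn`, `cn' = −sn·dn`, `dn' = −p²·sn·cn` with
`sn 0 = 0`, `cn 0 = 1`, `dn 0 = 1`. -/
structure IsJacobiSystem (p : ℝ) (sn cn dn : ℝ → ℝ) : Prop where
  sn_zero : sn 0 = 0
  cn_zero : cn 0 = 1
  dn_zero : dn 0 = 1
  hasDerivAt_sn : ∀ x : ℝ, HasDerivAt sn (cn x * dn x) x
  hasDerivAt_cn : ∀ x : ℝ, HasDerivAt cn (-(sn x * dn x)) x
  hasDerivAt_dn : ∀ x : ℝ, HasDerivAt dn (-(p ^ 2 * sn x * cn x)) x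

/-- The complete elliptic integral of the first kind is positive for moduli of absolute value
less than one. -/
theorem ellipticK_pos {p : ℝ} (hp : p ^ 2 < 1) : 0 < ellipticK p := by
  have hpos (θ : ℝ) : 0 < 1 - p ^ 2 * Real.sin θ ^ 2 := by
    nlinarith [Real.sin_sq_le_one θ, sq_nonneg p, sq_nonneg (Real.sin θ)]
  refine intervalIntegral.intervalIntegral_pos_of_pos ?_
    (fun θ => one_div_pos.2 (Real.sqrt_pos.2 (hpos θ))) (by positivity)
  refine Continuous.intervalIntegrable ?_ _ _
  exact continuous_const.div (by fun_prop) fun θ => (Real.sqrt_pos.2 (hpos θ)).ne'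

namespace IsJacobiSystem

variable {p : ℝ} {sn cn dn : ℝ → ℝ}

theorem continuous_sn (h : IsJacobiSystem p sn cn dn) : Continuous sn :=
  continuous_iff_continuousAt.2 fun x => (h.hasDerivAt_sn x).continuousAt

/-- The zero of `sn` at the origin is isolated. -/
theorem exists_sn_ne_zero (h : IsJacobiSystem p sn cn dn) {ε : ℝ} (hε : 0 < ε) :
    ∃ y ∈ Set.Ioo 0 ε, sn y ≠ 0 := by
  have hne : ∀ᶠ y in nhdsWithin (0 : ℝ) {0}ᶜ, sn y ≠ 0 :=
    (h.hasDerivAt_sn 0).eventually_ne (by simp [h.cn_zero, h.dn_zero])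
  have hright : ∀ᶠ y in nhdsWithin (0 : ℝ) (Set.Ioi 0), sn y ≠ 0 :=
    hne.filter_mono (nhdsWithin_mono _ fun y hy => ne_of_gt hy)
  exact (Filter.Eventually.and (Ioo_mem_nhdsGT hε) hright).exists

end IsJacobiSystem

/-- The strict Rayleigh-quotient estimate proving that the first positive eigenvalue of the
Laplacian of the minimal Lagrangian Klein bottle `K_{n,m}` satisfies `λ₁ < 2 − 1/(2b³)`
(Proposition 5.3(1)). -/
theorem rayleigh_quotient_estimate (b : ℝ) (hb : 1 < b)
    (q r p : ℝ)
    (hq2 : q ^ 2 = 1 - (1 + Real.sqrt (1 + 8 * b ^ 3)) / (4 * b ^ 3)) (hq0 : 0 < q)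
    (hr2 : r ^ 2 = b - (1 - Real.sqrt (1 + 8 * b ^ 3)) / (4 * b ^ 2)) (hr0 : 0 < r)
    (hp2 : p ^ 2 = b * q ^ 2 / r ^ 2) (hp0 : 0 < p ^ 2) (hp1 : p ^ 2 < 1)
    (sn cn dn : ℝ → ℝ) (hJ : IsJacobiSystem p sn cn dn)
    (w : ℝ → ℝ) (hw : ∀ x : ℝ, w x = b * (1 - q ^ 2 * sn (r * x) ^ 2)) :
    ∫ x in (0:ℝ)..(4 * ellipticK p / r), (2 * w x - 1 / (2 * b ^ 2)) * sn (r * x) ^ 2 <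
      (2 - 1 / (2 * b ^ 3)) *
        ∫ x in (0:ℝ)..(4 * ellipticK p / r), w x * sn (r * x) ^ 2 := by
  have hb0 : 0 < b := by linarith
  have hT : 0 < 4 * ellipticK p / r := by have := ellipticK_pos hp1; positivity
  have hcs : Continuous sn := hJ.continuous_sn
  have hgap (x : ℝ) : (2 - 1 / (2 * b ^ 3)) * (w x * sn (r * x) ^ 2) -
      (2 * w x - 1 / (2 * b ^ 2)) * sn (r * x) ^ 2 =
        q ^ 2 / (2 * b ^ 2) * (sn (r * x) ^ 2) ^ 2 := by
    rw [hw]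
    field_simp
    ring
  have hcw : Continuous w := by
    rw [funext hw]
    fun_prop
  rw [← intervalIntegral.integral_const_mul]
  obtain ⟨y, hy, hsn⟩ := hJ.exists_sn_ne_zero (mul_pos hr0 hT)
  have hry : r * (y / r) = y := by field_simp
  refine intervalIntegral.integral_lt_integral_of_continuousOn_of_le_of_exists_lt hT
    (Continuous.continuousOn (by fun_prop)) (Continuous.continuousOn (by fun_prop))
    (fun x _ => ?_) ⟨y / r, ⟨?_, ?_⟩, ?_⟩
  · rw [← sub_nonneg, hgap]
    positivity
  · exact (div_pos hy.1 hr0).le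
  · rw [div_le_iff₀ hr0, mul_comm]
    exact hy.2.le
  · rw [← sub_pos, hgap, hry]
    positivity
end

section
/- Let b ≥ 1 be a real number, set q² = 1 − (1+√(1+8b³))/(4b³), r² = b − (1−√(1+8b³))/(4b²) and p² = b·q²/r², and let u : ℝ → ℝ be a twice differentiable function satisfying u''(x) + e^{2u(x)} − e^{−4u(x)} = 0 for all x ∈ ℝ, with e^{2u(0)} = b and u'(0) = 0. Then u is periodic with period 2K(p)/r: u(x + 2K(p)/r) = u(x) for all x ∈ ℝ. -/
theorem ellipticK_modulus_pos {p : ℝ} (hp : p ^ 2 < 1) (θ : ℝ) : 0 < 1 - p ^ 2 * Real.sin θ ^ 2 := by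
  nlinarith [Real.sin_sq_le_one θ, sq_nonneg p, sq_nonneg (Real.sin θ)]

/-- The elliptic integral of the first kind over one full period of the integrand. -/
theorem integral_add_pi_eq_two_mul_ellipticK {p : ℝ} (hp : p ^ 2 < 1) (x : ℝ) :
    ∫ θ in x..(x + Real.pi), 1 / √(1 - p ^ 2 * Real.sin θ ^ 2) = 2 * ellipticK p := by
  have hcont : Continuous fun θ : ℝ => 1 / √(1 - p ^ 2 * Real.sin θ ^ 2) :=
    continuous_const.div (by fun_prop) fun θ =>
      (Real.sqrt_pos.2 (ellipticK_modulus_pos hp θ)).ne'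
  have hper : Function.Periodic (fun θ : ℝ => 1 / √(1 - p ^ 2 * Real.sin θ ^ 2)) Real.pi := by
    intro θ
    simp [Real.sin_add_pi]
  have hrefl := intervalIntegral.integral_comp_sub_left
    (fun θ : ℝ => 1 / √(1 - p ^ 2 * Real.sin θ ^ 2)) Real.pi (a := 0) (b := Real.pi / 2)
  simp only [Real.sin_pi_sub, sub_zero, sub_half] at hrefl
  rw [hper.intervalIntegral_add_eq x 0, zero_add,
    ← intervalIntegral.integral_add_adjacent_intervals
      (hcont.intervalIntegrable 0 (Real.pi / 2)) (hcont.intervalIntegrable (Real.pi / 2) Real.pi),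
    ← hrefl, ellipticK, two_mul]

/-- Existence of the Jacobi amplitude function. -/
theorem exists_jacobi_amplitude {p : ℝ} (hp : p ^ 2 < 1) :
    ∃ a : ℝ → ℝ, a 0 = 0 ∧ (∀ x, HasDerivAt a (√(1 - p ^ 2 * Real.sin (a x) ^ 2)) x) ∧
      ∀ x, a (x + 2 * ellipticK p) = a x + Real.pi := by
  set f : ℝ → ℝ := fun θ => 1 / √(1 - p ^ 2 * Real.sin θ ^ 2) with hf
  have hpos : ∀ θ, 0 < √(1 - p ^ 2 * Real.sin θ ^ 2) := fun θ =>
    Real.sqrt_pos.2 (ellipticK_modulus_pos hp θ)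
  have hcont : Continuous f := continuous_const.div (by fun_prop) fun θ => (hpos θ).ne'
  have hf1 : ∀ θ, 1 ≤ f θ := fun θ => by
    rw [hf, le_div_iff₀ (hpos θ), one_mul, Real.sqrt_le_iff]
    refine ⟨zero_le_one, ?_⟩
    nlinarith [mul_nonneg (sq_nonneg p) (sq_nonneg (Real.sin θ))]
  set F : ℝ → ℝ := fun x => ∫ θ in (0 : ℝ)..x, f θ with hF
  have hderiv : ∀ x, HasDerivAt F (f x) x := fun x =>
    (hcont.integral_hasStrictDerivAt 0 x).hasDerivAt
  have hFcont : Continuous F := continuous_iff_continuousAt.2 fun x => (hderiv x).continuousAt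
  have hmono : StrictMono F := strictMono_of_deriv_pos fun x => by
    rw [(hderiv x).deriv]
    exact zero_lt_one.trans_le (hf1 x)
  have hsub : Monotone fun x => F x - x :=
    monotone_of_deriv_nonneg (fun x => ((hderiv x).sub (hasDerivAt_id x)).differentiableAt)
      fun x => by
        have h : deriv (fun x => F x - x) x = f x - 1 := ((hderiv x).sub (hasDerivAt_id x)).deriv
        rw [h]
        linarith [hf1 x]
  have hF0 : F 0 = 0 := by simp [hF]
  have htop : Filter.Tendsto F Filter.atTop Filter.atTop :=
    Filter.tendsto_atTop_mono' _ (by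
      filter_upwards [Filter.eventually_ge_atTop 0] with x hx
      have := hsub hx
      simp only [hF0] at this
      simp only [id]
      linarith) Filter.tendsto_id
  have hbot : Filter.Tendsto F Filter.atBot Filter.atBot :=
    Filter.tendsto_atBot_mono' _ (by
      filter_upwards [Filter.eventually_le_atBot 0] with x hx
      have := hsub hx
      simp only [hF0] at this
      simp only [id]
      linarith) Filter.tendsto_id
  let e := hmono.orderIsoOfSurjective F (hFcont.surjective htop hbot)
  have he : ∀ x, F (e.symm x) = x := fun x => e.apply_symm_apply x
  refine ⟨e.symm, hmono.injective (by rw [he, hF0]), fun x => ?_, fun x => hmono.injective ?_⟩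
  · have h := (hderiv (e.symm x)).of_local_left_inverse e.symm.continuous.continuousAt
      (zero_lt_one.trans_le (hf1 _)).ne' (Filter.Eventually.of_forall he)
    simpa [hf] using h
  · have hadd := intervalIntegral.integral_add_adjacent_intervals
      (μ := MeasureTheory.volume) (hcont.intervalIntegrable 0 (e.symm x))
      (hcont.intervalIntegrable (e.symm x) (e.symm x + Real.pi))
    rw [integral_add_pi_eq_two_mul_ellipticK hp] at hadd
    rw [he]
    have := he x
    simp only [hF] at this ⊢
    rw [← hadd, this]

/-- Global solutions of an autonomous second order equation with smooth right-hand side are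
determined by their initial data. -/
theorem second_order_ode_unique {g : ℝ → ℝ} (hg : ContDiff ℝ 1 g) {v v' w w' : ℝ → ℝ}
    (hv : ∀ x, HasDerivAt v (v' x) x) (hv' : ∀ x, HasDerivAt v' (g (v x)) x)
    (hw : ∀ x, HasDerivAt w (w' x) x) (hw' : ∀ x, HasDerivAt w' (g (w x)) x)
    (h0 : v 0 = w 0) (h0' : v' 0 = w' 0) : v = w := by
  have hV : ∀ x, HasDerivAt (fun x => (v x, v' x)) (v' x, g (v x)) x := fun x =>
    (hv x).prodMk (hv' x)
  have hW : ∀ x, HasDerivAt (fun x => (w x, w' x)) (w' x, g (w x)) x := fun x =>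
    (hw x).prodMk (hw' x)
  have hVc : Continuous fun x => (v x, v' x) :=
    continuous_iff_continuousAt.2 fun x => (hV x).continuousAt
  have hWc : Continuous fun x => (w x, w' x) :=
    continuous_iff_continuousAt.2 fun x => (hW x).continuousAt
  funext x
  set T := |x| + 1 with hT
  have hK := ((isCompact_Icc (a := -T) (b := T)).image hVc).union
    ((isCompact_Icc (a := -T) (b := T)).image hWc)
  obtain ⟨R, hR⟩ := hK.isBounded.subset_closedBall 0
  have hfield : ContDiff ℝ 1 fun z : ℝ × ℝ => (z.2, g z.1) :=
    contDiff_snd.prodMk (hg.comp contDiff_fst)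
  obtain ⟨K, hLip⟩ := hfield.contDiffOn.exists_lipschitzOnWith one_ne_zero
    (convex_closedBall (0 : ℝ × ℝ) R) (isCompact_closedBall _ _)
  have hx := abs_lt.1 (lt_add_one |x|)
  have hT0 : 0 < T := by positivity
  have := ODE_solution_unique_of_mem_Ioo (v := fun _ z => (z.2, g z.1))
    (s := fun _ => Metric.closedBall 0 R) (fun _ _ => hLip)
    (⟨neg_lt_zero.2 hT0, hT0⟩ : (0 : ℝ) ∈ Set.Ioo (-T) T)
    (fun t ht => ⟨hV t, hR (Or.inl ⟨t, Set.Ioo_subset_Icc_self ht, rfl⟩)⟩)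
    (fun t ht => ⟨hW t, hR (Or.inr ⟨t, Set.Ioo_subset_Icc_self ht, rfl⟩)⟩)
    (Prod.ext h0 h0') hx
  exact congrArg Prod.fst this

/-- The explicit solution of `w'' = 4 (3 b - A - r²) w - 6 w²` in terms of the Jacobi amplitude. -/
theorem hasDerivAt_jacobi_solution {b A r p : ℝ} (hp : p ^ 2 < 1) (hA : A = r ^ 2 * p ^ 2)
    (hroot : 3 * b ^ 2 - 2 * b * (A + r ^ 2) + A * r ^ 2 = 0) {a : ℝ → ℝ}
    (ha : ∀ x, HasDerivAt a (√(1 - p ^ 2 * Real.sin (a x) ^ 2)) x) (x : ℝ) :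
    HasDerivAt (fun x => b - A * Real.sin (a (r * x)) ^ 2)
      (-(2 * A * r) * (Real.sin (a (r * x)) * Real.cos (a (r * x)) *
        √(1 - p ^ 2 * Real.sin (a (r * x)) ^ 2))) x ∧
    HasDerivAt (fun x => -(2 * A * r) * (Real.sin (a (r * x)) * Real.cos (a (r * x)) *
        √(1 - p ^ 2 * Real.sin (a (r * x)) ^ 2)))
      (4 * (3 * b - A - r ^ 2) * (b - A * Real.sin (a (r * x)) ^ 2) -
        6 * (b - A * Real.sin (a (r * x)) ^ 2) ^ 2) x := by
  have hpos := ellipticK_modulus_pos hp (a (r * x))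
  have hφ : HasDerivAt (fun x => a (r * x)) (√(1 - p ^ 2 * Real.sin (a (r * x)) ^ 2) * r) x := by
    have h := (ha (r * x)).comp x ((hasDerivAt_id x).const_mul r)
    simpa [Function.comp_def] using h
  have hs := hφ.sin
  have hc := hφ.cos
  have hΔ := (((hs.fun_pow 2).const_mul (p ^ 2)).const_sub 1).sqrt hpos.ne'
  have hsq := Real.sq_sqrt hpos.le
  have hne := (Real.sqrt_pos.2 hpos).ne'
  have hcs := Real.cos_sq' (a (r * x))
  constructor
  · refine (((hs.fun_pow 2).const_mul A).const_sub b).congr_deriv ?_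
    push_cast
    ring
  · refine (((hs.mul hc).mul hΔ).const_mul (-(2 * A * r))).congr_deriv ?_
    simp only [Pi.mul_apply]
    generalize √(1 - p ^ 2 * Real.sin (a (r * x)) ^ 2) = D at *
    generalize Real.sin (a (r * x)) = s at *
    generalize Real.cos (a (r * x)) = c at *
    have hD : -(p ^ 2 * (((2 : ℕ) : ℝ) * s ^ (2 - 1) * (c * (D * r)))) / (2 * D)
        = -(p ^ 2 * s * c * r) := by
      field_simp
      norm_num
      ring
    rw [hD]
    have e : -(2 * A * r) * ((c * (D * r) * c + s * (-s * (D * r))) * D +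
        s * c * -(p ^ 2 * s * c * r)) =
        -(2 * A * r ^ 2) * ((c ^ 2 - s ^ 2) * D ^ 2 - p ^ 2 * s ^ 2 * c ^ 2) := by ring
    rw [e, hsq, hcs]
    subst hA
    linear_combination (-2 : ℝ) * hroot

/-- Every solution of the conformal-factor ODE `u'' + e^{2u} − e^{−4u} = 0` with
`e^{2u(0)} = b` and `u'(0) = 0` is periodic with period `2K(p)/r`, where
`q² = 1 − (1+√(1+8b³))/(4b³)`, `r² = b − (1−√(1+8b³))/(4b²)` and `p² = bq²/r²`. -/
theorem solution_of_conformal_ODE_periodic (b : ℝ) (hb : 1 ≤ b)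
    (q r p : ℝ)
    (hq2 : q ^ 2 = 1 - (1 + Real.sqrt (1 + 8 * b ^ 3)) / (4 * b ^ 3))
    (hr2 : r ^ 2 = b - (1 - Real.sqrt (1 + 8 * b ^ 3)) / (4 * b ^ 2)) (hr0 : 0 < r)
    (hp2 : p ^ 2 = b * q ^ 2 / r ^ 2) (hp0 : 0 ≤ p)
    (u u' u'' : ℝ → ℝ)
    (hu : ∀ x : ℝ, HasDerivAt u (u' x) x)
    (hu' : ∀ x : ℝ, HasDerivAt u' (u'' x) x)
    (hode : ∀ x : ℝ, u'' x + Real.exp (2 * u x) - Real.exp (-4 * u x) = 0)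
    (h0 : Real.exp (2 * u 0) = b) (h0' : u' 0 = 0) :
    ∀ x : ℝ, u (x + 2 * ellipticK p / r) = u x := by
  have hb0 : 0 < b := by linarith
  have hrsq : 0 < r ^ 2 := by positivity
  have hS0 : 0 < √(1 + 8 * b ^ 3) := Real.sqrt_pos.2 (by positivity)
  have hS2 : √(1 + 8 * b ^ 3) ^ 2 = 1 + 8 * b ^ 3 := Real.sq_sqrt (by positivity)
  set S := √(1 + 8 * b ^ 3)
  set A := b * q ^ 2 with hAdef
  have hA : A = r ^ 2 * p ^ 2 := by
    rw [hp2]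
    field_simp
  have hA' : A = b - (1 + S) / (4 * b ^ 2) := by
    rw [hAdef, hq2]
    field_simp
  have hp1 : p ^ 2 < 1 := by
    rw [hp2, div_lt_one hrsq, hr2, hA', sub_lt_sub_iff_left]
    gcongr
    linarith
  have hroot : 3 * b ^ 2 - 2 * b * (A + r ^ 2) + A * r ^ 2 = 0 := by
    rw [hA', hr2]
    field_simp
    linear_combination (-1 : ℝ) * hS2
  have hE : 3 * b - A - r ^ 2 = b + 1 / (2 * b ^ 2) := by
    rw [hA', hr2]
    field_simp
    ring
  have hexp : ∀ x, Real.exp (-4 * u x) = 1 / Real.exp (2 * u x) ^ 2 := fun x => by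
    rw [← Real.exp_nat_mul, one_div, ← Real.exp_neg]
    congr 1
    push_cast
    ring
  have hv : ∀ x, HasDerivAt (fun x => Real.exp (2 * u x)) (2 * u' x * Real.exp (2 * u x)) x :=
    fun x => by
      refine (((hu x).const_mul 2).exp).congr_deriv ?_
      ring
  have henergy : ∀ x, u' x ^ 2 + Real.exp (2 * u x) + Real.exp (-4 * u x) / 2 =
      b + 1 / (2 * b ^ 2) := by
    have hd : ∀ x, HasDerivAt
        (fun x => u' x ^ 2 + Real.exp (2 * u x) + Real.exp (-4 * u x) / 2) 0 x := fun x => by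
      refine ((((hu' x).fun_pow 2).add (hv x)).add (((hu x).const_mul (-4)).exp.div_const 2)).congr_deriv ?_
      push_cast
      linear_combination (2 * u' x) * hode x
    intro x
    have h := is_const_of_deriv_eq_zero (fun x => (hd x).differentiableAt)
      (fun x => (hd x).deriv) x 0
    simp only [hexp, h0, h0'] at h ⊢
    rw [h]
    field_simp
    ring
  have hv' : ∀ x, HasDerivAt (fun x => 2 * u' x * Real.exp (2 * u x))
      (4 * (3 * b - A - r ^ 2) * Real.exp (2 * u x) - 6 * Real.exp (2 * u x) ^ 2) x := fun x => by
    refine (((hu' x).const_mul 2).mul (hv x)).congr_deriv ?_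
    have h1 := hode x
    have h2 := henergy x
    rw [hexp] at h1 h2
    have hne := Real.exp_ne_zero (2 * u x)
    rw [hE, ← h2]
    have h3 : u'' x = 1 / Real.exp (2 * u x) ^ 2 - Real.exp (2 * u x) := by linarith
    rw [h3]
    field_simp
    ring
  obtain ⟨a, ha0, ha, haper⟩ := exists_jacobi_amplitude hp1
  have hw := hasDerivAt_jacobi_solution hp1 hA hroot ha
  have hvw := second_order_ode_unique
    (g := fun z => 4 * (3 * b - A - r ^ 2) * z - 6 * z ^ 2) (by fun_prop)
    hv hv' (fun x => (hw x).1) (fun x => (hw x).2) (by simp [h0, ha0]) (by simp [h0', ha0])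
  intro x
  have hper : Real.exp (2 * u (x + 2 * ellipticK p / r)) = Real.exp (2 * u x) := by
    have h1 := congrFun hvw (x + 2 * ellipticK p / r)
    have h2 := congrFun hvw x
    have h3 : r * (x + 2 * ellipticK p / r) = r * x + 2 * ellipticK p := by field_simp
    simp only [h3, haper, Real.sin_add_pi, neg_sq] at h1 h2
    rw [h1, h2]
  linarith [Real.exp_injective hper]
end

section
/- For every modulus p ∈ [0,1) and every x ∈ ℝ, the Jacobi elliptic functions of modulus p satisfy sn(x + 2K(p)) = −sn(x), cn(x + 2K(p)) = −cn(x) and dn(x + 2K(p)) = dn(x); in particular sn, cn and dn are periodic with period 4K(p). -/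
/-- The integrand of the incomplete elliptic integral of the first kind. -/
noncomputable def ellipticIntegrand (p θ : ℝ) : ℝ :=
  1 / Real.sqrt (1 - p ^ 2 * Real.sin θ ^ 2)

/-- The incomplete elliptic integral of the first kind. -/
noncomputable def ellipticF (p θ : ℝ) : ℝ :=
  ∫ t in (0:ℝ)..θ, ellipticIntegrand p t

/-- If two differentiable real functions have the same derivative and agree at `0`,
they are equal. -/
theorem eq_of_hasDerivAt_eq_of_zero {f g f' : ℝ → ℝ} (hf : ∀ x, HasDerivAt f (f' x) x)
    (hg : ∀ x, HasDerivAt g (f' x) x) (h0 : f 0 = g 0) (x : ℝ) : f x = g x := by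
  have h : ∀ x, HasDerivAt (fun y => f y - g y) 0 x := fun x => by
    simpa using (hf x).fun_sub (hg x)
  have := is_const_of_deriv_eq_zero (fun x => (h x).differentiableAt) (fun x => (h x).deriv) x 0
  simp only [h0, sub_self] at this
  linarith

section EllipticIntegral

variable {p : ℝ}

theorem one_sub_sq_mul_sin_sq_pos (hp0 : 0 ≤ p) (hp1 : p < 1) (θ : ℝ) :
    0 < 1 - p ^ 2 * Real.sin θ ^ 2 := by
  nlinarith [Real.sin_sq_le_one θ, sq_nonneg p, sq_nonneg (Real.sin θ)]

theorem ellipticIntegrand_pos (hp0 : 0 ≤ p) (hp1 : p < 1) (θ : ℝ) :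
    0 < ellipticIntegrand p θ :=
  one_div_pos.2 (Real.sqrt_pos.2 (one_sub_sq_mul_sin_sq_pos hp0 hp1 θ))

theorem continuous_ellipticIntegrand (hp0 : 0 ≤ p) (hp1 : p < 1) :
    Continuous (ellipticIntegrand p) := by
  unfold ellipticIntegrand
  refine continuous_const.div (by fun_prop) fun θ => ?_
  exact (Real.sqrt_pos.2 (one_sub_sq_mul_sin_sq_pos hp0 hp1 θ)).ne'

theorem ellipticIntegrand_periodic : Function.Periodic (ellipticIntegrand p) Real.pi := by
  intro θ
  simp [ellipticIntegrand, Real.sin_add_pi]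

theorem hasDerivAt_ellipticF (hp0 : 0 ≤ p) (hp1 : p < 1) (θ : ℝ) :
    HasDerivAt (ellipticF p) (ellipticIntegrand p θ) θ :=
  (continuous_ellipticIntegrand hp0 hp1).integral_hasStrictDerivAt 0 θ |>.hasDerivAt

theorem ellipticF_strictMono (hp0 : 0 ≤ p) (hp1 : p < 1) : StrictMono (ellipticF p) :=
  strictMono_of_deriv_pos fun θ => by
    rw [(hasDerivAt_ellipticF hp0 hp1 θ).deriv]
    exact ellipticIntegrand_pos hp0 hp1 θ

theorem ellipticF_pi (hp0 : 0 ≤ p) (hp1 : p < 1) : ellipticF p Real.pi = 2 * ellipticK p := by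
  have hi (a b : ℝ) : IntervalIntegrable (ellipticIntegrand p) MeasureTheory.volume a b :=
    (continuous_ellipticIntegrand hp0 hp1).intervalIntegrable a b
  have hK : ellipticK p = ∫ θ in (0:ℝ)..(Real.pi / 2), ellipticIntegrand p θ := rfl
  have hr : ∫ θ in (Real.pi / 2)..Real.pi, ellipticIntegrand p θ = ellipticK p := by
    have h := intervalIntegral.integral_comp_sub_left (a := 0) (b := Real.pi / 2)
      (ellipticIntegrand p) Real.pi
    rw [sub_zero, sub_half] at h
    rw [← h, hK]
    simp [ellipticIntegrand, Real.sin_pi_sub]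
  rw [ellipticF, ← intervalIntegral.integral_add_adjacent_intervals (hi 0 (Real.pi / 2)) (hi _ _),
    hr, ← hK, two_mul]

theorem ellipticF_add_pi (hp0 : 0 ≤ p) (hp1 : p < 1) (θ : ℝ) :
    ellipticF p (θ + Real.pi) = ellipticF p θ + 2 * ellipticK p := by
  have hi (a b : ℝ) : IntervalIntegrable (ellipticIntegrand p) MeasureTheory.volume a b :=
    (continuous_ellipticIntegrand hp0 hp1).intervalIntegrable a b
  have h := ellipticIntegrand_periodic (p := p) |>.intervalIntegral_add_eq θ 0
  rw [zero_add] at h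
  rw [← ellipticF_pi hp0 hp1]
  unfold ellipticF
  rw [← h, intervalIntegral.integral_add_adjacent_intervals (hi _ _) (hi _ _)]

end EllipticIntegral

namespace IsJacobiSystem

variable {p : ℝ} {sn cn dn : ℝ → ℝ}

theorem sn_sq_add_cn_sq (hJ : IsJacobiSystem p sn cn dn) (x : ℝ) : sn x ^ 2 + cn x ^ 2 = 1 := by
  refine eq_of_hasDerivAt_eq_of_zero (f := fun x => sn x ^ 2 + cn x ^ 2) (g := fun _ => 1)
    (f' := fun _ => 0) (fun x => ?_) (fun x => hasDerivAt_const x 1) ?_ x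
  · refine (((hJ.hasDerivAt_sn x).fun_pow 2).fun_add ((hJ.hasDerivAt_cn x).fun_pow 2)).congr_deriv ?_
    ring
  · simp [hJ.sn_zero, hJ.cn_zero]

theorem dn_sq (hJ : IsJacobiSystem p sn cn dn) (x : ℝ) : dn x ^ 2 = 1 - p ^ 2 * sn x ^ 2 := by
  refine eq_of_hasDerivAt_eq_of_zero (f := fun x => dn x ^ 2)
    (g := fun x => 1 - p ^ 2 * sn x ^ 2)
    (f' := fun x => -(2 * p ^ 2 * sn x * cn x * dn x)) (fun x => ?_) (fun x => ?_) ?_ x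
  · refine ((hJ.hasDerivAt_dn x).fun_pow 2).congr_deriv ?_
    ring
  · refine ((((hJ.hasDerivAt_sn x).fun_pow 2).const_mul (p ^ 2)).const_sub 1).congr_deriv ?_
    ring
  · simp [hJ.sn_zero, hJ.dn_zero]

theorem continuous_dn (hJ : IsJacobiSystem p sn cn dn) : Continuous dn :=
  continuous_iff_continuousAt.2 fun x => (hJ.hasDerivAt_dn x).continuousAt

theorem dn_pos (hJ : IsJacobiSystem p sn cn dn) (hp0 : 0 ≤ p) (hp1 : p < 1) (x : ℝ) :
    0 < dn x := by
  by_contra! h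
  obtain ⟨y, hy⟩ : (0 : ℝ) ∈ Set.range dn :=
    mem_range_of_exists_le_of_exists_ge hJ.continuous_dn ⟨x, h⟩ ⟨0, by simp [hJ.dn_zero]⟩
  have h1 := hJ.dn_sq y
  rw [hy] at h1
  nlinarith [hJ.sn_sq_add_cn_sq y, sq_nonneg (cn y), sq_nonneg (sn y), sq_nonneg p]

/-- The Jacobi amplitude, `am x = ∫₀ˣ dn`, satisfies `sn = sin ∘ am` and `cn = cos ∘ am`. -/
theorem exists_amplitude (hJ : IsJacobiSystem p sn cn dn) :
    ∃ am : ℝ → ℝ, am 0 = 0 ∧ (∀ x, HasDerivAt am (dn x) x) ∧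
      (∀ x, sn x = Real.sin (am x)) ∧ ∀ x, cn x = Real.cos (am x) := by
  obtain ⟨am, h0, hd⟩ : ∃ am : ℝ → ℝ, am 0 = 0 ∧ ∀ x, HasDerivAt am (dn x) x :=
    ⟨fun x => ∫ t in (0:ℝ)..x, dn t, by simp, fun x =>
      (hJ.continuous_dn.integral_hasStrictDerivAt 0 x).hasDerivAt⟩
  have hA : ∀ x, sn x * Real.cos (am x) - cn x * Real.sin (am x) = 0 := by
    refine eq_of_hasDerivAt_eq_of_zero (f' := fun _ => 0) (fun x => ?_)
      (fun x => hasDerivAt_const x 0) ?_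
    · refine (((hJ.hasDerivAt_sn x).fun_mul (hd x).cos).fun_sub
        ((hJ.hasDerivAt_cn x).fun_mul (hd x).sin)).congr_deriv ?_
      ring
    · simp [h0, hJ.sn_zero]
  have hB : ∀ x, cn x * Real.cos (am x) + sn x * Real.sin (am x) = 1 := by
    refine eq_of_hasDerivAt_eq_of_zero (f' := fun _ => 0) (fun x => ?_)
      (fun x => hasDerivAt_const x 1) ?_
    · refine (((hJ.hasDerivAt_cn x).fun_mul (hd x).cos).fun_add
        ((hJ.hasDerivAt_sn x).fun_mul (hd x).sin)).congr_deriv ?_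
      ring
    · simp [h0, hJ.cn_zero]
  refine ⟨am, h0, hd, fun x => ?_, fun x => ?_⟩
  · linear_combination Real.cos (am x) * hA x + Real.sin (am x) * hB x
      - sn x * Real.sin_sq_add_cos_sq (am x)
  · linear_combination Real.cos (am x) * hB x - Real.sin (am x) * hA x
      - cn x * Real.sin_sq_add_cos_sq (am x)

theorem dn_eq_sqrt (hJ : IsJacobiSystem p sn cn dn) (hp0 : 0 ≤ p) (hp1 : p < 1) (x : ℝ) :
    dn x = Real.sqrt (1 - p ^ 2 * sn x ^ 2) := by
  rw [← hJ.dn_sq, Real.sqrt_sq (hJ.dn_pos hp0 hp1 x).le]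

theorem ellipticF_amplitude (hJ : IsJacobiSystem p sn cn dn) (hp0 : 0 ≤ p) (hp1 : p < 1)
    {am : ℝ → ℝ} (h0 : am 0 = 0) (hd : ∀ x, HasDerivAt am (dn x) x)
    (hs : ∀ x, sn x = Real.sin (am x)) (x : ℝ) : ellipticF p (am x) = x := by
  refine eq_of_hasDerivAt_eq_of_zero (f := fun x => ellipticF p (am x)) (g := fun x => x)
    (f' := fun _ => 1) (fun x => ?_) hasDerivAt_id' ?_ x
  · refine ((hasDerivAt_ellipticF hp0 hp1 (am x)).comp x (hd x)).congr_deriv ?_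
    rw [ellipticIntegrand, ← hs, ← hJ.dn_eq_sqrt hp0 hp1,
      one_div_mul_cancel (hJ.dn_pos hp0 hp1 x).ne']
  · simp [h0, ellipticF]

theorem half_period (hJ : IsJacobiSystem p sn cn dn) (hp0 : 0 ≤ p) (hp1 : p < 1) (x : ℝ) :
    sn (x + 2 * ellipticK p) = -sn x ∧ cn (x + 2 * ellipticK p) = -cn x ∧
      dn (x + 2 * ellipticK p) = dn x := by
  obtain ⟨am, h0, hd, hs, hc⟩ := hJ.exists_amplitude
  have hF := hJ.ellipticF_amplitude hp0 hp1 h0 hd hs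
  have ham : am (x + 2 * ellipticK p) = am x + Real.pi :=
    (ellipticF_strictMono hp0 hp1).injective <| by
      rw [ellipticF_add_pi hp0 hp1, hF, hF]
  have hsn : sn (x + 2 * ellipticK p) = -sn x := by rw [hs, hs, ham, Real.sin_add_pi]
  refine ⟨hsn, by rw [hc, hc, ham, Real.cos_add_pi], ?_⟩
  rw [hJ.dn_eq_sqrt hp0 hp1, hJ.dn_eq_sqrt hp0 hp1, hsn, neg_sq]

end IsJacobiSystem

/-- Symmetry and periodicity of the Jacobi elliptic functions:
`sn(x+2K) = −sn(x)`, `cn(x+2K) = −cn(x)`, `dn(x+2K) = dn(x)`; in particular `sn`, `cn`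
and `dn` are periodic with period `4K(p)`. -/
theorem jacobi_periodicity (p : ℝ) (hp0 : 0 ≤ p) (hp1 : p < 1)
    (sn cn dn : ℝ → ℝ) (hJ : IsJacobiSystem p sn cn dn) :
    (∀ x : ℝ, sn (x + 2 * ellipticK p) = -sn x ∧ cn (x + 2 * ellipticK p) = -cn x ∧
        dn (x + 2 * ellipticK p) = dn x) ∧
      Function.Periodic sn (4 * ellipticK p) ∧ Function.Periodic cn (4 * ellipticK p) ∧
        Function.Periodic dn (4 * ellipticK p) := by
  have h := hJ.half_period hp0 hp1
  have h4 (x : ℝ) : x + 4 * ellipticK p = x + 2 * ellipticK p + 2 * ellipticK p := by ring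
  refine ⟨h, fun x => ?_, fun x => ?_, fun x => ?_⟩
  · rw [h4, (h _).1, (h x).1, neg_neg]
  · rw [h4, (h _).2.1, (h x).2.1, neg_neg]
  · rw [h4, (h _).2.2, (h x).2.2]
end
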